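/- arXiv:2007.05705 — 2 statements merged into one kernel-verified Lean document; each statement's English description precedes it below -/
import Mathlib

section
/- Let n ∈ ℕ, equip ℝⁿ with the maximum norm and the standard positive cone ℝⁿ₊ (componentwise order), and let A : ℝⁿ₊ → ℝⁿ₊ be continuous and monotone. Then the following are equivalent: (i) the discrete-time system x(k+1) ≤ A(x(k)) + u(k) has the monotone limit (MLIM) property; (ii) the operator id − A has the monotone bounded invertibility (MBI) property; (iii) there exists η of class K∞ such that dist(A(x) − x, ℝⁿ₊) ≥ η(‖x‖) for all x ∈ ℝⁿ₊; (iv) there exists η of class K∞ such that A(x) ≱ x − η(‖x‖)𝟏 for all x ∈ ℝⁿ₊ \ {0}, where 𝟏 = (1,…,1). -/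
open Filter Set

noncomputable section

/-- A function of class `K`: continuous on `[0,∞)`, strictly increasing on `[0,∞)`,
and vanishing at `0`. -/
def IsClassK (γ : ℝ → ℝ) : Prop :=
  ContinuousOn γ (Set.Ici 0) ∧ StrictMonoOn γ (Set.Ici 0) ∧ γ 0 = 0

/-- A function of class `K∞`: class `K` and unbounded. -/
def IsClassKInf (γ : ℝ → ℝ) : Prop :=
  IsClassK γ ∧ Filter.Tendsto γ Filter.atTop Filter.atTop

/-- A function of class `K ∪ {0}`: either of class `K` or identically zero on `[0,∞)`. -/
def IsClassK0 (γ : ℝ → ℝ) : Prop :=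
  IsClassK γ ∨ Set.EqOn γ 0 (Set.Ici 0)
/-- The monotone limit (MLIM) property of the discrete-time system
`x(k+1) ≤ A(x(k)) + u(k)` induced by `A` on the cone `C`
(order: `x ≤ y` iff `y - x ∈ C`). -/
def MLIM {X : Type*} [NormedAddCommGroup X] (C : Set X) (A : X → X) : Prop :=
  ∃ ξ : ℝ → ℝ, IsClassKInf ξ ∧
    ∀ ε : ℝ, 0 < ε → ∀ w ∈ C, ∀ x : ℕ → X,
      (∀ k, x k ∈ C) → (∀ k, x k - x (k + 1) ∈ C) →
      (∀ k, A (x k) + w - x (k + 1) ∈ C) →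
      ∃ N : ℕ, ‖x N‖ ≤ ε + ξ ‖w‖

/-- The monotone bounded invertibility (MBI) property of `id - A` on the cone `C`:
`v - A(v) ≤ w` implies `‖v‖ ≤ ξ(‖w‖)`. -/
def MBI {X : Type*} [NormedAddCommGroup X] (C : Set X) (A : X → X) : Prop :=
  ∃ ξ : ℝ → ℝ, IsClassKInf ξ ∧
    ∀ v ∈ C, ∀ w ∈ C, w - (v - A v) ∈ C → ‖v‖ ≤ ξ ‖w‖

lemma kinf_inverse {γ : ℝ → ℝ} (h : IsClassKInf γ) :
    ∃ ζ : ℝ → ℝ, IsClassKInf ζ ∧ (∀ s, 0 ≤ s → 0 ≤ ζ s) ∧ (∀ s, 0 ≤ s → γ (ζ s) = s) ∧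
      (∀ r, 0 ≤ r → ζ (γ r) = r) := by
  obtain ⟨⟨hc, hm, h0⟩, ht⟩ := h
  set g : ℝ → ℝ := fun x => γ (max x 0) + min x 0 with hg
  have gpos : ∀ x, 0 ≤ x → g x = γ x := fun x hx => by simp [hg, hx]
  have gneg : ∀ x, x ≤ 0 → g x = x := fun x hx => by simp [hg, hx, h0]
  have gc : Continuous g := by
    refine Continuous.add ?_ (by fun_prop)
    exact hc.comp_continuous (by fun_prop) (fun x => by simp)
  have gm : StrictMono g := by
    intro x y hxy
    rcases le_total 0 x with hx | hx
    · rw [gpos x hx, gpos y (hx.trans hxy.le)]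
      exact hm hx (hx.trans hxy.le) hxy
    · rcases le_total y 0 with hy | hy
      · rwa [gneg x hx, gneg y hy]
      · rw [gneg x hx, gpos y hy]
        have h1 : γ 0 ≤ γ y := hm.monotoneOn (by simp) hy hy
        rcases hy.eq_or_lt with rfl | hy'
        · rw [h0]; exact hxy
        · have h1 : γ 0 < γ y := hm (by simp) hy hy'
          linarith
  have gt : Tendsto g atTop atTop := by
    refine ht.congr' ?_
    filter_upwards [eventually_ge_atTop 0] with x hx
    exact (gpos x hx).symm
  have gb : Tendsto g atBot atBot := by
    refine tendsto_id.congr' ?_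
    filter_upwards [eventually_le_atBot 0] with x hx
    exact (gneg x hx).symm
  let e := gm.orderIsoOfSurjective g (gc.surjective gt gb)
  have ee : ∀ x, e x = g x := fun x => rfl
  have e0 : e.symm 0 = 0 := by
    rw [OrderIso.symm_apply_eq, ee, gneg 0 le_rfl]
  have en : ∀ s, 0 ≤ s → 0 ≤ e.symm s := fun s hs => by
    rw [← e0]; exact e.symm.monotone hs
  refine ⟨e.symm, ⟨⟨e.symm.continuous.continuousOn, e.symm.strictMono.strictMonoOn _, e0⟩,
    e.symm.tendsto_atTop⟩, en, fun s hs => ?_, fun r hr => ?_⟩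
  · rw [← gpos _ (en s hs), ← ee, OrderIso.apply_symm_apply]
  · rw [← gpos r hr, ← ee, OrderIso.symm_apply_apply]

/-- For `ℝⁿ` with the maximum norm and the standard positive cone,
and `A : ℝⁿ₊ → ℝⁿ₊` continuous and monotone, the following are equivalent:
(i) MLIM; (ii) MBI; (iii) the uniform small-gain condition; (iv) the uniform small-gain
condition with unit `𝟏 = (1,…,1)`. -/
theorem finite_dim_small_gain_conditions_tfae
    (n : ℕ) (hn : 0 < n)
    (C : Set (Fin n → ℝ)) (hC : C = {x : Fin n → ℝ | ∀ i, 0 ≤ x i})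
    (A : (Fin n → ℝ) → Fin n → ℝ)
    (hA : ∀ x ∈ C, A x ∈ C)
    (hcont : ContinuousOn A C)
    (hmono : ∀ x ∈ C, ∀ y ∈ C, (∀ i, x i ≤ y i) → ∀ i, A x i ≤ A y i) :
    List.TFAE
      [ MLIM C A,
        MBI C A,
        ∃ η : ℝ → ℝ, IsClassKInf η ∧ ∀ x ∈ C, η ‖x‖ ≤ Metric.infDist (A x - x) C,
        ∃ η : ℝ → ℝ, IsClassKInf η ∧ ∀ x ∈ C, x ≠ 0 →
          ¬ ∀ i, x i - η ‖x‖ ≤ A x i ] := by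
  subst hC
  have hNe : Nonempty (Fin n) := ⟨⟨0, hn⟩⟩
  have hCne : ({x : Fin n → ℝ | ∀ i, 0 ≤ x i}).Nonempty := ⟨0, fun i => le_rfl⟩
  tfae_have 1 → 2 := by
    rintro ⟨ξ, hξ, H⟩
    refine ⟨ξ, hξ, fun v hv w hw h => ?_⟩
    refine le_of_forall_pos_le_add fun ε hε => ?_
    obtain ⟨N, hN⟩ := H ε hε w hw (fun _ => v) (fun _ => hv) (fun _ i => by simp)
      (fun _ i => by have := h i; simp at this ⊢; linarith)
    linarith
  tfae_have 2 → 1 := by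
    rintro ⟨ξ, hξ, H⟩
    refine ⟨ξ, hξ, fun ε hε w hw x hx hd hs => ?_⟩
    have hlim : ∀ i, ∃ l, Tendsto (fun k => x k i) atTop (nhds l) := fun i => by
      refine ⟨_, tendsto_atTop_ciInf (antitone_nat_of_succ_le fun k => ?_) ⟨0, ?_⟩⟩
      · have := hd k i; simp at this; exact this
      · rintro _ ⟨k, rfl⟩; exact hx k i
    choose l hl using hlim
    have hL : Tendsto x atTop (nhds l) := tendsto_pi_nhds.2 hl
    have hlC : l ∈ {x : Fin n → ℝ | ∀ i, 0 ≤ x i} :=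
      fun i => ge_of_tendsto' (hl i) (fun k => hx k i)
    have hAL : Tendsto (fun k => A (x k)) atTop (nhds (A l)) :=
      (hcont l hlC).tendsto.comp (tendsto_nhdsWithin_iff.2 ⟨hL, Eventually.of_forall hx⟩)
    have hle : ∀ i, l i ≤ A l i + w i := fun i => by
      refine le_of_tendsto_of_tendsto' ((hl i).comp (tendsto_add_atTop_nat 1))
        ((tendsto_pi_nhds.1 hAL i).add_const (w i)) (fun k => ?_)
      have := hs k i
      simp at this ⊢; linarith
    have hb := H l hlC w hw (fun i => by have := hle i; simp; linarith)
    have := hL.norm.eventually (gt_mem_nhds (show ‖l‖ < ε + ξ ‖w‖ by linarith))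
    obtain ⟨N, hN⟩ := this.exists
    exact ⟨N, hN.le⟩
  tfae_have 2 → 3 := by
    rintro ⟨ξ, hξ, H⟩
    obtain ⟨ζ, hζ, -, -, hi⟩ := kinf_inverse hξ
    refine ⟨ζ, hζ, fun x hx => ?_⟩
    refine (Metric.le_infDist hCne).2 fun z hz => ?_
    have hw : ‖x‖ ≤ ξ ‖(fun _ => dist (A x - x) z : Fin n → ℝ)‖ := by
      refine H x hx _ (fun i => dist_nonneg) (fun i => ?_)
      have h1 := dist_le_pi_dist (A x - x) z i
      rw [Real.dist_eq] at h1
      have h2 := neg_abs_le ((A x - x) i - z i)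
      have h3 := hz i
      simp only [Pi.sub_apply] at h1 h2 ⊢; linarith
    rw [pi_norm_const, Real.norm_of_nonneg dist_nonneg] at hw
    have hx0 : 0 ≤ ξ (dist (A x - x) z) := (norm_nonneg x).trans hw
    rw [← hi (dist (A x - x) z) dist_nonneg]
    exact hζ.1.2.1.monotoneOn (norm_nonneg x) hx0 hw
  tfae_have 3 → 2 := by
    rintro ⟨η, hη, H⟩
    obtain ⟨ζ, hζ, -, -, hi⟩ := kinf_inverse hη
    refine ⟨ζ, hζ, fun v hv w hw h => ?_⟩
    have h1 : η ‖v‖ ≤ ‖w‖ := by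
      refine (H v hv).trans ((Metric.infDist_le_dist_of_mem h).trans ?_)
      rw [dist_eq_norm, show A v - v - (w - (v - A v)) = -w by abel, norm_neg]
    have h0 : 0 ≤ η ‖v‖ := by
      rw [← hη.1.2.2]; exact hη.1.2.1.monotoneOn (by simp) (norm_nonneg v) (norm_nonneg v)
    rw [← hi ‖v‖ (norm_nonneg v)]
    exact hζ.1.2.1.monotoneOn h0 (norm_nonneg w) h1
  tfae_have 3 → 4 := by
    rintro ⟨η, hη, H⟩
    refine ⟨fun r => η r / 2, ⟨⟨hη.1.1.div_const 2, fun a ha b hb hab => ?_, ?_⟩, ?_⟩,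
      fun x hx hx0 h => ?_⟩
    · have := hη.1.2.1 ha hb hab
      simp only; linarith
    · simp [hη.1.2.2]
    · exact hη.2.atTop_div_const (by norm_num)
    · have hp : 0 < η ‖x‖ := by
        rw [← hη.1.2.2]; exact hη.1.2.1 (by simp) (norm_nonneg x) (norm_pos_iff.2 hx0)
      have hm : (A x - x + fun _ => η ‖x‖ / 2) ∈ {x : Fin n → ℝ | ∀ i, 0 ≤ x i} := fun i => by
        have := h i
        simp at this ⊢; linarith
      have h1 := (H x hx).trans (Metric.infDist_le_dist_of_mem hm)
      rw [dist_self_add_right, pi_norm_const, Real.norm_of_nonneg (by linarith)] at h1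
      linarith
  tfae_have 4 → 3 := by
    rintro ⟨η, hη, H⟩
    refine ⟨η, hη, fun x hx => ?_⟩
    by_cases hx0 : x = 0
    · rw [hx0, norm_zero, hη.1.2.2]; exact Metric.infDist_nonneg
    have h := H x hx hx0
    push Not at h
    obtain ⟨i, hi⟩ := h
    refine (Metric.le_infDist hCne).2 fun z hz => ?_
    have h1 := dist_le_pi_dist (A x - x) z i
    rw [Real.dist_eq] at h1
    have h2 := neg_abs_le ((A x - x) i - z i)
    have h3 := hz i
    simp only [Pi.sub_apply] at h1 h2; linarith
  tfae_finish
end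
end

section
/- The following statements hold for comparison functions: (i) for any α of class K∞ there exists η of class K∞ such that η(r) ≤ α(r) for all r ≥ 0 and id − η is of class K∞ (i.e., r ↦ r − η(r) is of class K∞); (ii) for any η of class K∞ with id − η of class K∞, there exists ρ of class K∞ such that (id − η)⁻¹ = id + ρ; (iii) for any η of class K∞ with id − η of class K∞, there exist η₁, η₂ of class K∞ with id − η₁ and id − η₂ of class K∞ such that id − η = (id − η₁) ∘ (id − η₂). -/
open Filter Set

noncomputable section

theorem IsClassKInf.nonneg {f : ℝ → ℝ} (hf : IsClassKInf f) {r : ℝ} (hr : 0 ≤ r) : 0 ≤ f r := by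
  have h := hf.1.2.1.monotoneOn (mem_Ici.2 le_rfl) (mem_Ici.2 hr) hr
  rwa [hf.1.2.2] at h

theorem IsClassKInf.congr {f g : ℝ → ℝ} (hf : IsClassKInf f) (h : ∀ r, 0 ≤ r → g r = f r) :
    IsClassKInf g := by
  have he : EqOn g f (Ici 0) := fun r hr => h r hr
  refine ⟨⟨hf.1.1.congr he, hf.1.2.1.congr he.symm, (h 0 le_rfl).trans hf.1.2.2⟩, ?_⟩
  refine hf.2.congr' ?_
  filter_upwards [eventually_ge_atTop 0] with r hr using (h r hr).symm

theorem IsClassKInf.comp {f g : ℝ → ℝ} (hf : IsClassKInf f) (hg : IsClassKInf g) :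
    IsClassKInf (fun r => f (g r)) := by
  have hm : MapsTo g (Ici 0) (Ici 0) := fun r hr => hg.nonneg hr
  refine ⟨⟨hf.1.1.comp hg.1.1 hm, hf.1.2.1.comp hg.1.2.1 hm, ?_⟩, hf.2.comp hg.2⟩
  simp only [hg.1.2.2, hf.1.2.2]

theorem IsClassKInf.add {f g : ℝ → ℝ} (hf : IsClassKInf f) (hg : IsClassKInf g) :
    IsClassKInf (fun r => f r + g r) := by
  refine ⟨⟨hf.1.1.add hg.1.1, fun a ha b hb hab =>
    add_lt_add (hf.1.2.1 ha hb hab) (hg.1.2.1 ha hb hab), ?_⟩, hf.2.atTop_add_atTop hg.2⟩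
  simp only [hg.1.2.2, hf.1.2.2, add_zero]

theorem IsClassKInf.id : IsClassKInf (fun r => r) :=
  ⟨⟨continuousOn_id, fun _ _ _ _ h => h, rfl⟩, tendsto_id⟩

theorem IsClassKInf.half {f : ℝ → ℝ} (hf : IsClassKInf f) : IsClassKInf (fun r => f r / 2) := by
  refine ⟨⟨hf.1.1.div_const 2, fun a ha b hb hab => ?_, ?_⟩, hf.2.atTop_div_const two_pos⟩
  · have := hf.1.2.1 ha hb hab
    show f a / 2 < f b / 2
    linarith
  · simp [hf.1.2.2]

theorem IsClassKInf.inv {f : ℝ → ℝ} (hf : IsClassKInf f) :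
    ∃ g, IsClassKInf g ∧ (∀ r, 0 ≤ r → g (f r) = r) ∧ (∀ r, 0 ≤ r → f (g r) = r) := by
  let F : ℝ → ℝ := fun x => f (max x 0) + min x 0
  have hF0 : ∀ x, 0 ≤ x → F x = f x := fun x hx => by simp [F, hx]
  have hFn : ∀ x, x ≤ 0 → F x = x := fun x hx => by simp [F, hx, hf.1.2.2]
  have hc : Continuous F := by
    refine Continuous.add ?_ (by fun_prop)
    exact hf.1.1.comp_continuous (by fun_prop) (fun x => mem_Ici.2 (le_max_right _ _))
  have hs : StrictMono F := by
    intro a b hab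
    rcases le_or_gt 0 a with ha | ha
    · rw [hF0 a ha, hF0 b (ha.trans hab.le)]
      exact hf.1.2.1 ha (ha.trans hab.le) hab
    · rw [hFn a ha.le]
      rcases le_or_gt 0 b with hb | hb
      · rw [hF0 b hb]
        exact ha.trans_le (hf.nonneg hb)
      · rwa [hFn b hb.le]
  have ht : Tendsto F atTop atTop := by
    refine hf.2.congr' ?_
    filter_upwards [eventually_ge_atTop 0] with r hr using (hF0 r hr).symm
  have hb : Tendsto F atBot atBot := by
    refine tendsto_id.congr' ?_
    filter_upwards [eventually_le_atBot 0] with r hr using (hFn r hr).symm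
  let e := hs.orderIsoOfSurjective F (hc.surjective ht hb)
  have he : ∀ x, e x = F x := fun x => rfl
  have h0 : e.symm 0 = 0 := by
    rw [OrderIso.symm_apply_eq, he, hFn 0 le_rfl]
  refine ⟨e.symm, ⟨⟨e.symm.continuous.continuousOn, e.symm.strictMono.strictMonoOn _, h0⟩,
    e.symm.tendsto_atTop⟩, fun r hr => ?_, fun r hr => ?_⟩
  · rw [OrderIso.symm_apply_eq, he, hF0 r hr]
  · have : 0 ≤ e.symm r := by
      rw [← h0]; exact e.symm.monotone hr
    rw [← hF0 _ this, ← he, OrderIso.apply_symm_apply]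

/-- (i) for any `α ∈ K∞` there is `η ∈ K∞` with `η ≤ α` on `[0,∞)` and
`id − η ∈ K∞`; (ii) for any `η ∈ K∞` with `id − η ∈ K∞` there is `ρ ∈ K∞` with
`(id − η)⁻¹ = id + ρ` on `[0,∞)`; (iii) for any `η ∈ K∞` with `id − η ∈ K∞` there are
`η₁, η₂ ∈ K∞` with `id − η₁, id − η₂ ∈ K∞` and `id − η = (id − η₁) ∘ (id − η₂)` on `[0,∞)`. -/
theorem comparison_function_lemmas :
    (∀ α : ℝ → ℝ, IsClassKInf α →
      ∃ η : ℝ → ℝ, IsClassKInf η ∧ (∀ r : ℝ, 0 ≤ r → η r ≤ α r) ∧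
        IsClassKInf (fun r => r - η r)) ∧
    (∀ η : ℝ → ℝ, IsClassKInf η → IsClassKInf (fun r => r - η r) →
      ∃ ρ : ℝ → ℝ, IsClassKInf ρ ∧
        (∀ r : ℝ, 0 ≤ r → (r - η r) + ρ (r - η r) = r) ∧
        (∀ r : ℝ, 0 ≤ r → (r + ρ r) - η (r + ρ r) = r)) ∧
    (∀ η : ℝ → ℝ, IsClassKInf η → IsClassKInf (fun r => r - η r) →
      ∃ η₁ η₂ : ℝ → ℝ, IsClassKInf η₁ ∧ IsClassKInf η₂ ∧
        IsClassKInf (fun r => r - η₁ r) ∧ IsClassKInf (fun r => r - η₂ r) ∧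
        ∀ r : ℝ, 0 ≤ r → r - η r = (r - η₂ r) - η₁ (r - η₂ r)) := by
  refine ⟨fun α hα => ?_, fun η hη hη' => ?_, fun η hη hη' => ?_⟩
  · obtain ⟨β, hβ, hβ1, hβ2⟩ := hα.inv
    obtain ⟨η, hη, -, h2⟩ := (IsClassKInf.id.add hβ).inv
    refine ⟨η, hη, fun r hr => ?_, (hβ.comp hη).congr fun r hr => ?_⟩
    · have h := h2 r hr
      have hn := hη.nonneg hr
      have h3 : β (η r) ≤ r := by linarith
      rw [← hβ2 _ hn]
      exact hα.1.2.1.monotoneOn (hβ.nonneg hn) hr h3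
    · have h := h2 r hr
      linarith
  · obtain ⟨g, hg, h1, h2⟩ := hη'.inv
    refine ⟨fun r => η (g r), hη.comp hg, fun r hr => ?_, fun r hr => ?_⟩
    · have h := h1 r hr
      simp only at h ⊢
      rw [h]; ring
    · have h := h2 r hr
      simp only at h ⊢
      have h3 : r + η (g r) = g r := by linarith
      rw [h3, h]
  · have hk : IsClassKInf (fun r => r - η r / 2) :=
      (IsClassKInf.id.half.add hη'.half).congr fun r _ => by ring
    obtain ⟨g, hg, h1, h2⟩ := hk.inv
    refine ⟨fun r => η (g r) / 2, fun r => η r / 2, hη.half.comp hg, hη.half,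
      (hη'.comp hg).congr fun r hr => ?_, hk, fun r hr => ?_⟩
    · have h := h2 r hr
      simp only at h ⊢
      linarith
    · have h := h1 r hr
      simp only at h ⊢
      rw [h]; ring
end
end
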